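/- Let H be a real Hilbert space and let F : H → H be Fréchet differentiable with derivative F'(u) at each u ∈ H. Let 0 < λ ≤ Λ be real constants such that for all u, v ∈ H one has λ‖v‖ ≤ ‖F'(u) v‖ and ‖F'(u) − F'(v)‖ ≤ Λ‖u − v‖ (operator norm), and suppose that for each u ∈ H the derivative F'(u) is a continuous linear equivalence of H with inverse N(u)⁻¹. Fix f ∈ H and u₀ ∈ H, and define the Newton iterates u_{t+1} = u_t − N(u_t)⁻¹(F(u_t) − f). Set q = Λ/(2λ²) and r = ‖F(u₀) − f‖. Then for every t ∈ ℕ, ‖F(u_t) − f‖ ≤ q^(2^t − 1) · r^(2^t). -/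

import Mathlib

/-- Quadratic bound on the first-order Taylor remainder of a map whose derivative is
Lipschitz. -/
theorem norm_taylor_remainder_le_of_lipschitz_fderiv
    {E G : Type*} [NormedAddCommGroup E] [NormedSpace ℝ E]
    [NormedAddCommGroup G] [NormedSpace ℝ G]
    {F : E → G} {F' : E → E →L[ℝ] G} {K : ℝ}
    (hF : ∀ x, HasFDerivAt F (F' x) x)
    (hLip : ∀ x y, ‖F' x - F' y‖ ≤ K * ‖x - y‖) (x h : E) :
    ‖F (x + h) - F x - F' x h‖ ≤ K / 2 * ‖h‖ ^ 2 := by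
  have hder (s : ℝ) : HasDerivAt (fun s : ℝ => F (x + s • h) - F x - s • F' x h)
      (F' (x + s • h) h - F' x h) s := by
    have hline : HasDerivAt (fun s : ℝ => x + s • h) h s := by
      simpa using ((hasDerivAt_id s).smul_const h).const_add x
    have hlin : HasDerivAt (fun s : ℝ => s • F' x h) (F' x h) s := by
      simpa using (hasDerivAt_id s).smul_const (F' x h)
    exact (((hF (x + s • h)).comp_hasDerivAt s hline).sub_const (F x)).sub hlin
  have hB (s : ℝ) :
      HasDerivAt (fun s : ℝ => K / 2 * ‖h‖ ^ 2 * s ^ 2) (K * ‖h‖ ^ 2 * s) s := by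
    refine ((hasDerivAt_pow 2 s).const_mul (K / 2 * ‖h‖ ^ 2)).congr_deriv ?_
    norm_num
    ring
  have hbound := image_norm_le_of_norm_deriv_right_le_deriv_boundary (a := 0) (b := 1)
    (fun s _ => (hder s).continuousAt.continuousWithinAt)
    (fun s _ => (hder s).hasDerivWithinAt) (by simp) hB
    (fun s hs => by
      calc ‖F' (x + s • h) h - F' x h‖
          = ‖(F' (x + s • h) - F' x) h‖ := rfl
        _ ≤ K * ‖x + s • h - x‖ * ‖h‖ :=
          ((F' (x + s • h) - F' x).le_opNorm h).trans (by gcongr; exact hLip _ _)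
        _ = K * ‖h‖ ^ 2 * s := by
          rw [add_sub_cancel_left, norm_smul, Real.norm_of_nonneg hs.1]
          ring)
  simpa using hbound (Set.right_mem_Icc.2 zero_le_one)

/-- The residual decreases quadratically under one Newton step, here for a correction `h`
solving the linearized equation. -/
theorem norm_residual_newton_step_le
    {E G : Type*} [NormedAddCommGroup E] [NormedSpace ℝ E]
    [NormedAddCommGroup G] [NormedSpace ℝ G]
    {F : E → G} {F' : E → E →L[ℝ] G} {c K : ℝ}
    (hF : ∀ x, HasFDerivAt F (F' x) x) (hc : 0 < c) (hK : 0 ≤ K)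
    (hlow : ∀ x v, c * ‖v‖ ≤ ‖F' x v‖)
    (hLip : ∀ x y, ‖F' x - F' y‖ ≤ K * ‖x - y‖)
    {x h : E} {f : G} (hh : F' x h = F x - f) :
    ‖F (x - h) - f‖ ≤ K / (2 * c ^ 2) * ‖F x - f‖ ^ 2 := by
  have htaylor := norm_taylor_remainder_le_of_lipschitz_fderiv hF hLip x (-h)
  rw [map_neg, hh, norm_neg, ← sub_eq_add_neg,
    show F (x - h) - F x - -(F x - f) = F (x - h) - f by abel] at htaylor
  have hnorm : c * ‖h‖ ≤ ‖F x - f‖ := hh ▸ hlow x h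
  calc ‖F (x - h) - f‖ ≤ K / 2 * ‖h‖ ^ 2 := htaylor
    _ = K / (2 * c ^ 2) * (c * ‖h‖) ^ 2 := by field_simp
    _ ≤ K / (2 * c ^ 2) * ‖F x - f‖ ^ 2 := by gcongr

/-- Closed form of the bound for a nonnegative sequence with `a (t + 1) ≤ q * a t ^ 2`. -/
theorem le_pow_two_pow_of_quadratic_recurrence {a : ℕ → ℝ} {q : ℝ} (hq : 0 ≤ q)
    (ha : ∀ t, 0 ≤ a t) (hstep : ∀ t, a (t + 1) ≤ q * a t ^ 2) (t : ℕ) :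
    a t ≤ q ^ (2 ^ t - 1) * a 0 ^ (2 ^ t) := by
  induction t with
  | zero => simp
  | succ t ih =>
    have hexp : 2 ^ (t + 1) - 1 = (2 ^ t - 1) * 2 + 1 := by
      have := Nat.one_le_two_pow (n := t)
      omega
    calc a (t + 1) ≤ q * a t ^ 2 := hstep t
      _ ≤ q * (q ^ (2 ^ t - 1) * a 0 ^ (2 ^ t)) ^ 2 := by
        have := ha t
        gcongr
      _ = q ^ (2 ^ (t + 1) - 1) * a 0 ^ (2 ^ (t + 1)) := by
        rw [hexp, pow_succ 2 t, pow_succ q, pow_mul, pow_mul]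
        ring

/-- Iterated residual bound for Newton's method
(from the proof of the paper's Lemma 1). -/
theorem newton_residual_bound
    {H : Type*} [NormedAddCommGroup H] [InnerProductSpace ℝ H] [CompleteSpace H]
    (F : H → H) (F' : H → H →L[ℝ] H)
    (hF : ∀ u : H, HasFDerivAt F (F' u) u)
    (lam Lam : ℝ) (hlam : 0 < lam) (hlamLam : lam ≤ Lam)
    (hlow : ∀ u v : H, lam * ‖v‖ ≤ ‖F' u v‖)
    (hLip : ∀ u v : H, ‖F' u - F' v‖ ≤ Lam * ‖u - v‖)
    (N : H → (H ≃L[ℝ] H)) (hN : ∀ u : H, ((N u : H ≃L[ℝ] H) : H →L[ℝ] H) = F' u)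
    (f : H) (u₀ : H) (u : ℕ → H) (hu0 : u 0 = u₀)
    (hstep : ∀ t : ℕ, u (t + 1) = u t - (N (u t)).symm (F (u t) - f))
    (q r : ℝ) (hq : q = Lam / (2 * lam ^ 2)) (hr : r = ‖F u₀ - f‖) :
    ∀ t : ℕ, ‖F (u t) - f‖ ≤ q ^ (2 ^ t - 1) * r ^ (2 ^ t) := by
  have hLam : 0 ≤ Lam := hlam.le.trans hlamLam
  subst hq hr
  rw [← hu0]
  refine le_pow_two_pow_of_quadratic_recurrence (a := fun t => ‖F (u t) - f‖)
    (by positivity) (fun t => norm_nonneg _) fun t => ?_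
  rw [hstep t]
  refine norm_residual_newton_step_le hF hlam hLam hlow hLip ?_
  rw [← hN]
  exact (N (u t)).apply_symm_apply _
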